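/- arXiv:1212.3936 — 3 statements merged into one kernel-verified Lean document; each statement's English description precedes it below -/
import Mathlib

section
/- Let M ⊆ ℝⁿ be a symmetric algebraic variety, i.e. M is the common zero set of finitely many real polynomials on ℝⁿ and σM = M for every permutation σ ∈ Σⁿ. Then the spectral set λ⁻¹(M) = {X ∈ Sⁿ : λ(X) ∈ M} is an algebraic variety of Sⁿ, i.e. it is the common zero set of finitely many real polynomials in the entries of X. -/
open scoped Classical
noncomputable section

/-- The vector `λ(A)` of eigenvalues of a (symmetric) matrix `A`, counted with
multiplicity (as roots of the characteristic polynomial) and ordered nonincreasingly: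
coordinate `i` is the `(i+1)`-th largest root. -/
noncomputable def lamVec {n : ℕ} (A : Matrix (Fin n) (Fin n) ℝ) : Fin n → ℝ :=
  fun i => (A.charpoly.roots.sort (· ≤ ·)).getD (n - 1 - (i : ℕ)) 0

/-- The polynomial `∑ σ, ∑ p ∈ P, (σ p) ^ 2`, a symmetric polynomial whose zero set is that of `P`
as soon as the latter is symmetric. -/
def symmSumSq {n : ℕ} (P : Finset (MvPolynomial (Fin n) ℝ)) : MvPolynomial (Fin n) ℝ :=
  ∑ σ : Equiv.Perm (Fin n), ∑ p ∈ P, MvPolynomial.rename σ p ^ 2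

theorem isSymmetric_symmSumSq {n : ℕ} (P : Finset (MvPolynomial (Fin n) ℝ)) :
    (symmSumSq P).IsSymmetric := by
  intro τ
  simp only [symmSumSq, map_sum, map_pow, MvPolynomial.rename_rename]
  exact Fintype.sum_equiv (Equiv.mulLeft τ) _ _ fun σ => rfl

theorem eval_symmSumSq_eq_zero_iff {n : ℕ} (P : Finset (MvPolynomial (Fin n) ℝ))
    (x : Fin n → ℝ) :
    MvPolynomial.eval x (symmSumSq P) = 0 ↔
      ∀ σ : Equiv.Perm (Fin n), ∀ p ∈ P, MvPolynomial.eval (x ∘ σ) p = 0 := by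
  simp only [symmSumSq, map_sum, map_pow, MvPolynomial.eval_rename]
  rw [Finset.sum_eq_zero_iff_of_nonneg fun σ _ => Finset.sum_nonneg fun p _ => sq_nonneg _]
  refine ⟨fun h σ p hp => ?_, fun h σ _ => Finset.sum_eq_zero fun p hp => by simp [h σ p hp]⟩
  have := (Finset.sum_eq_zero_iff_of_nonneg fun p _ => sq_nonneg _).1 (h σ (Finset.mem_univ _)) p hp
  exact pow_eq_zero_iff two_ne_zero |>.1 this

theorem card_roots_charpoly_of_isSymm {n : ℕ} {A : Matrix (Fin n) (Fin n) ℝ} (hA : A.IsSymm) :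
    A.charpoly.roots.card = A.charpoly.natDegree :=
  Polynomial.splits_iff_card_roots.1 <| Matrix.IsHermitian.splits_charpoly <| by
    rwa [Matrix.IsHermitian, Matrix.conjTranspose_eq_transpose_of_trivial]

theorem map_lamVec_eq_roots {n : ℕ} {A : Matrix (Fin n) (Fin n) ℝ} (hA : A.IsSymm) :
    Finset.univ.val.map (lamVec A) = A.charpoly.roots := by
  have hlen : (A.charpoly.roots.sort (· ≤ ·)).length = n := by
    simp [card_roots_charpoly_of_isSymm hA]
  have hrev : List.ofFn (lamVec A) = (A.charpoly.roots.sort (· ≤ ·)).reverse := by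
    refine List.ext_getElem (by simp [hlen]) fun i hi _ => ?_
    have hi' : i < n := by simpa using hi
    rw [List.getElem_ofFn, List.getElem_reverse, lamVec,
      List.getD_eq_getElem _ _ (by simp only [hlen]; omega)]
    simp only [hlen]
  rw [Fin.univ_val_map, hrev, Multiset.coe_reverse, Multiset.sort_eq]

/-- The `k`-th elementary symmetric function of the eigenvalues, as a polynomial in the entries. -/
def esymmEntries (n k : ℕ) : MvPolynomial (Fin n × Fin n) ℝ :=
  (-1) ^ k * (Matrix.charpoly.univ ℝ (Fin n)).coeff (n - k)

theorem eval_esymmEntries {n k : ℕ} (hk : k ≤ n) {A : Matrix (Fin n) (Fin n) ℝ} (hA : A.IsSymm) :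
    MvPolynomial.eval (fun p : Fin n × Fin n => A p.1 p.2) (esymmEntries n k) =
      MvPolynomial.eval (lamVec A) (MvPolynomial.esymm (Fin n) ℝ k) := by
  have hcoeff := Polynomial.coeff_eq_esymm_roots_of_card (card_roots_charpoly_of_isSymm hA)
    (k := n - k) (by simp)
  rw [A.charpoly_monic.leadingCoeff, Matrix.charpoly_natDegree_eq_dim, Fintype.card_fin,
    Nat.sub_sub_self hk, one_mul] at hcoeff
  have hentries : MvPolynomial.eval (fun p : Fin n × Fin n => A p.1 p.2)
      ((Matrix.charpoly.univ ℝ (Fin n)).coeff (n - k)) = A.charpoly.coeff (n - k) :=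
    Matrix.charpoly.univ_coeff_eval₂Hom (Fin n) (RingHom.id ℝ) (fun p => A p.1 p.2) (n - k)
  rw [← MvPolynomial.coe_aeval_eq_eval (lamVec A), RingHom.coe_coe,
    MvPolynomial.aeval_esymm_eq_multiset_esymm, map_lamVec_eq_roots hA, esymmEntries, map_mul,
    hentries, hcoeff, map_pow, map_neg, map_one, ← mul_assoc, ← mul_pow, neg_one_mul, neg_neg,
    one_pow, one_mul]

/-- **Transferring algebraicity.** If `M ⊆ ℝⁿ` is a symmetric algebraic variety
(the common zero set of finitely many real polynomials, invariant under all
permutations of coordinates), then the spectral set `λ⁻¹(M)` is an algebraic variety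
of the space of symmetric matrices: it is the common zero set, within symmetric
matrices, of finitely many real polynomials in the entries of the matrix. -/
theorem spectral_set_of_symmetric_algebraic_variety_is_algebraic
    {n : ℕ} (M : Set (Fin n → ℝ))
    (hsym : ∀ σ : Equiv.Perm (Fin n),
      (fun x : Fin n → ℝ => fun i => x (σ⁻¹ i)) '' M = M)
    (P : Finset (MvPolynomial (Fin n) ℝ))
    (hM : M = {x : Fin n → ℝ | ∀ p ∈ P, MvPolynomial.eval x p = 0}) :
    ∃ Q : Finset (MvPolynomial (Fin n × Fin n) ℝ),
      ∀ A : Matrix (Fin n) (Fin n) ℝ, A.IsSymm →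
        (lamVec A ∈ M ↔ ∀ q ∈ Q, MvPolynomial.eval (fun p : Fin n × Fin n => A p.1 p.2) q = 0) := by
  obtain ⟨g, hg⟩ := MvPolynomial.esymmAlgHom_surjective (σ := Fin n) ℝ (Fintype.card_fin n).le
    ⟨symmSumSq P, isSymmetric_symmSumSq P⟩
  have hg' : MvPolynomial.aeval (fun i : Fin n => MvPolynomial.esymm (Fin n) ℝ (i + 1)) g =
      symmSumSq P := by
    rw [← MvPolynomial.esymmAlgHom_apply, hg]
  have hmem (x : Fin n → ℝ) : x ∈ M ↔ MvPolynomial.eval x (symmSumSq P) = 0 := by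
    rw [eval_symmSumSq_eq_zero_iff]
    constructor
    · intro hx σ
      have : x ∘ σ ∈ M := by
        rw [← hsym σ⁻¹]
        exact ⟨x, hx, by ext i; simp⟩
      rwa [hM] at this
    · intro h
      rw [hM]
      exact h 1
  refine ⟨{MvPolynomial.aeval (fun i : Fin n => esymmEntries n (i + 1)) g}, fun A hA => ?_⟩
  rw [hmem, ← hg']
  simp only [Finset.mem_singleton, forall_eq]
  have hcomp (m : Type) (x : m → ℝ) :
      (MvPolynomial.eval x).comp MvPolynomial.C = RingHom.id ℝ :=
    RingHom.ext fun r => MvPolynomial.eval_C r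
  have h (i : Fin n) := eval_esymmEntries (k := i + 1) i.2 hA
  simp only [MvPolynomial.map_aeval, MvPolynomial.algebraMap_eq, hcomp, h]
end
end

section
/- Let σ, σ′ ∈ Σⁿ. Then: (a) σ ≾ σ′ if and only if Δ(σ) ⊆ Δ(σ′)^⊥⊥; (b) the following are equivalent: σ ∼ σ′; Δ(σ) ∩ Δ(σ′) ≠ ∅; Δ(σ) = Δ(σ′). -/
noncomputable section

/-- The partition `P(σ)` associated to a permutation `σ` is the partition into the
orbits of `σ` (supports of its cycles together with singletons of fixed points); `i`
and `j` lie in the same block iff `σ.SameCycle i j`.  The stratum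
`Δ(σ) = {x : P(x) = P(σ)}`. -/
def Delta {n : ℕ} (σ : Equiv.Perm (Fin n)) : Set (Fin n → ℝ) :=
  {x | ∀ i j : Fin n, x i = x j ↔ σ.SameCycle i j}

/-- `Δ(σ)^⊥⊥ = {x : x i = x j whenever i, j lie in the same block of P(σ)}`. -/
def DeltaBiperp {n : ℕ} (σ : Equiv.Perm (Fin n)) : Set (Fin n → ℝ) :=
  {x | ∀ i j : Fin n, σ.SameCycle i j → x i = x j}

theorem Delta_nonempty {n : ℕ} (σ : Equiv.Perm (Fin n)) : (Delta σ).Nonempty := by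
  let s := Equiv.Perm.SameCycle.setoid σ
  refine ⟨fun i => ((Quotient.mk s i).out : ℕ), fun i j => ?_⟩
  rw [Nat.cast_inj, Fin.val_inj, Quotient.out_inj]
  exact Quotient.eq

theorem Delta_eq_of_sameCycle_iff {n : ℕ} {σ σ' : Equiv.Perm (Fin n)}
    (h : ∀ i j : Fin n, σ.SameCycle i j ↔ σ'.SameCycle i j) : Delta σ = Delta σ' := by
  simp only [Delta, h]

theorem sameCycle_iff_of_mem_Delta {n : ℕ} {σ σ' : Equiv.Perm (Fin n)} {x : Fin n → ℝ}
    (hx : x ∈ Delta σ) (hx' : x ∈ Delta σ') (i j : Fin n) :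
    σ.SameCycle i j ↔ σ'.SameCycle i j :=
  (hx i j).symm.trans (hx' i j)

theorem Delta_subset_DeltaBiperp_iff {n : ℕ} (σ σ' : Equiv.Perm (Fin n)) :
    Delta σ ⊆ DeltaBiperp σ' ↔ ∀ i j : Fin n, σ'.SameCycle i j → σ.SameCycle i j := by
  refine ⟨fun h i j hij => ?_, fun h x hx i j hij => (hx i j).2 (h i j hij)⟩
  obtain ⟨x, hx⟩ := Delta_nonempty σ
  exact (hx i j).1 (h hx i j hij)

/-- **Proposition (Properties of Δ(σ), (ii)).**
(a) `σ ≾ σ'` (i.e. `P(σ) ⊆ P(σ')`, every block of `P(σ)` is a union of blocks of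
`P(σ')`) iff `Δ(σ) ⊆ Δ(σ')^⊥⊥`;
(b) `σ ∼ σ'` (i.e. `P(σ) = P(σ')`) iff `Δ(σ) ∩ Δ(σ') ≠ ∅` iff `Δ(σ) = Δ(σ')`. -/
theorem delta_order_characterizations {n : ℕ} (σ σ' : Equiv.Perm (Fin n)) :
    ((∀ i j : Fin n, σ'.SameCycle i j → σ.SameCycle i j) ↔ Delta σ ⊆ DeltaBiperp σ') ∧
    ((∀ i j : Fin n, σ.SameCycle i j ↔ σ'.SameCycle i j) ↔ (Delta σ ∩ Delta σ').Nonempty) ∧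
    ((Delta σ ∩ Delta σ').Nonempty ↔ Delta σ = Delta σ') := by
  have eq_of_nonempty : (Delta σ ∩ Delta σ').Nonempty → Delta σ = Delta σ' :=
    fun ⟨_, hx, hx'⟩ => Delta_eq_of_sameCycle_iff (sameCycle_iff_of_mem_Delta hx hx')
  have nonempty_of_eq (h : Delta σ = Delta σ') : (Delta σ ∩ Delta σ').Nonempty := by
    rw [← h, Set.inter_self]
    exact Delta_nonempty σ
  exact ⟨(Delta_subset_DeltaBiperp_iff σ σ').symm,
    ⟨fun h => nonempty_of_eq (Delta_eq_of_sameCycle_iff h),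
      fun ⟨_, hx, hx'⟩ => sameCycle_iff_of_mem_Delta hx hx'⟩,
    ⟨eq_of_nonempty, nonempty_of_eq⟩⟩
end
end

section
/- Let n ≥ 2 and let y = (y₁,…,yₙ) ∈ ℝⁿ be such that the coordinates y₁,…,yₙ are not all equal. Let Y be the (n!+1) × (n+1) real matrix whose first row is (1,…,1,0) ∈ ℝ^{n+1} and whose remaining rows are (σy, 1) for each σ ∈ Σⁿ. Then Y has full column rank n+1. -/
noncomputable section

/-- If `∑ i, v i * y (σ⁻¹ i)` does not depend on `σ` and `y` is not constant, then `v` is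
constant. -/
theorem eq_of_sum_mul_perm_eq {ι R : Type*} [Fintype ι] [DecidableEq ι] [CommRing R]
    [NoZeroDivisors R] {v y : ι → R} {c : R} {a b : ι} (hab : y a ≠ y b)
    (h : ∀ σ : Equiv.Perm ι, ∑ i, v i * y (σ⁻¹ i) = c) (i j : ι) : v i = v j := by
  by_cases hij : i = j
  · rw [hij]
  have hne : a ≠ b := fun e => hab (congrArg y e)
  obtain ⟨σ, ha, hb⟩ : ∃ σ : Equiv.Perm ι, σ a = i ∧ σ b = j := by
    refine ⟨Equiv.swap (Equiv.swap a i b) j * Equiv.swap a i, ?_, ?_⟩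
    · have : i ≠ Equiv.swap a i b := fun e => hne <| by
        apply (Equiv.swap a i).injective
        rwa [Equiv.swap_apply_left]
      rw [Equiv.Perm.mul_apply, Equiv.swap_apply_left, Equiv.swap_apply_of_ne_of_ne this hij]
    · rw [Equiv.Perm.mul_apply, Equiv.swap_apply_left]
  have hi : σ⁻¹ i = a := Equiv.Perm.inv_eq_iff_eq.2 ha.symm
  have hj : σ⁻¹ j = b := Equiv.Perm.inv_eq_iff_eq.2 hb.symm
  have hsub : ∑ k, (v k * y (σ⁻¹ k) - v k * y ((Equiv.swap i j * σ)⁻¹ k)) = 0 := by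
    rw [Finset.sum_sub_distrib, h, h, sub_self]
  rw [Fintype.sum_eq_add i j hij fun k hk => by
    simp [mul_inv_rev, Equiv.swap_apply_of_ne_of_ne hk.1 hk.2]] at hsub
  simp only [mul_inv_rev, Equiv.swap_inv, Equiv.Perm.mul_apply, Equiv.swap_apply_left,
    Equiv.swap_apply_right, hi, hj] at hsub
  have hmul : (v i - v j) * (y a - y b) = 0 := by linear_combination hsub
  exact sub_eq_zero.1 ((mul_eq_zero.1 hmul).resolve_right (sub_ne_zero.2 hab))

/-- **Matrix of full rank.** Let `n ≥ 2` and let `y ∈ ℝⁿ` have not-all-equal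
coordinates.  The `(n!+1) × (n+1)` matrix `Y` whose rows are indexed by
`Option (Equiv.Perm (Fin n))` (a type with `n!+1` elements), with the row at `none`
equal to `(1,…,1,0)` and the row at `some σ` equal to `(σy, 1)` (the vector
`i ↦ y (σ⁻¹ i)` followed by a final entry `1`), has full column rank `n+1`. -/
theorem perm_matrix_full_rank {n : ℕ} (hn : 2 ≤ n) (y : Fin n → ℝ)
    (hy : ¬ ∀ i j : Fin n, y i = y j) :
    (Matrix.of fun (r : Option (Equiv.Perm (Fin n))) (c : Fin (n + 1)) =>
        Option.elim r
          ((Fin.snoc (fun _ : Fin n => (1 : ℝ)) (0 : ℝ) : Fin (n + 1) → ℝ) c)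
          (fun σ => (Fin.snoc (fun i : Fin n => y (σ⁻¹ i)) (1 : ℝ) : Fin (n + 1) → ℝ) c)).rank
      = n + 1 := by
  push Not at hy
  obtain ⟨a, b, hab⟩ := hy
  rw [Matrix.rank, LinearMap.finrank_range_of_inj, Module.finrank_fin_fun]
  rw [← LinearMap.ker_eq_bot, LinearMap.ker_eq_bot']
  intro v hv
  have hsum : ∑ i : Fin n, v i.castSucc = 0 := by
    simpa [Matrix.mulVec, dotProduct, Fin.sum_univ_castSucc] using congrFun hv none
  have hperm (σ : Equiv.Perm (Fin n)) :
      ∑ i : Fin n, v i.castSucc * y (σ⁻¹ i) = -v (Fin.last n) := by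
    have := congrFun hv (some σ)
    simp only [Matrix.mulVecLin_apply, Matrix.mulVec, dotProduct, Matrix.of_apply,
      Option.elim_some, Fin.sum_univ_castSucc, Fin.snoc_castSucc, Fin.snoc_last, one_mul,
      Pi.zero_apply] at this
    simpa only [mul_comm] using eq_neg_of_add_eq_zero_left this
  have hconst := eq_of_sum_mul_perm_eq (v := fun i : Fin n => v i.castSucc) hab hperm
  have hinit (i : Fin n) : v i.castSucc = 0 := by
    rw [Finset.sum_congr rfl fun j _ => hconst j i] at hsum
    simpa [show n ≠ 0 by omega] using hsum
  have hlast : v (Fin.last n) = 0 := by simpa [hinit] using hperm 1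
  funext c
  exact Fin.lastCases hlast hinit c
end
end
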